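/- Let (W,S) be a Coxeter system of rank 3 with S = {r,s,t}, in which rt = tr (the product rt has order 2), the order of st equals 3, and the order m_{sr} of sr satisfies m_{sr} ≥ 7 (possibly infinite). Then there is no element w of W admitting elements w₁, w₂ ∈ W with w = w₁·s·r·s·r, ℓ(w) = ℓ(w₁) + 4, and w = w₂·t, ℓ(w) = ℓ(w₂) + 1. -/

import Mathlib

open LaurentPolynomial

namespace CoxeterSystem

open List

variable {B W : Type*} [Group W] {M : CoxeterMatrix B} (cs : CoxeterSystem M W)

open Classical in
/-- The action of a simple reflection on `W × ZMod 2` by conjugation on the first factor, with a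
flip of the sign at the reflection itself. -/
noncomputable def signedConj (i : B) : Function.End (W × ZMod 2) :=
  fun p ↦ (cs.simple i * p.1 * cs.simple i, p.2 + if p.1 = cs.simple i then 1 else 0)

theorem functionEnd_mul_apply {α : Type*} (f g : Function.End α) (a : α) : (f * g) a = f (g a) := rfl

open Classical in
theorem signedConj_mul_pow_apply (i j : B) (n : ℕ) (p : W × ZMod 2) :
    ((cs.signedConj i * cs.signedConj j) ^ n) p =
      ((cs.simple i * cs.simple j) ^ n * p.1 * (cs.simple j * cs.simple i) ^ n,
        p.2 + ∑ k ∈ Finset.range (2 * n),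
          if p.1 = (cs.simple j * cs.simple i) ^ k * cs.simple j then 1 else 0) := by
  induction n with
  | zero => simp [Function.End.one_def]
  | succ n ih =>
    have inv_pow_mul : ((cs.simple i * cs.simple j) ^ n)⁻¹ = (cs.simple j * cs.simple i) ^ n := by
      rw [← inv_pow, mul_inv_rev, inv_simple, inv_simple]
    have conj_pow : (cs.simple j * cs.simple i) ^ n * cs.simple j =
        cs.simple j * (cs.simple i * cs.simple j) ^ n := mul_pow_mul (cs.simple j) (cs.simple i) n
    have even_term : (cs.simple i * cs.simple j) ^ n * p.1 * (cs.simple j * cs.simple i) ^ n =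
        cs.simple j ↔ p.1 = (cs.simple j * cs.simple i) ^ (2 * n) * cs.simple j := by
      rw [← inv_pow_mul, mul_inv_eq_iff_eq_mul, ← eq_inv_mul_iff_mul_eq, inv_pow_mul, ← mul_assoc,
        mul_assoc, ← conj_pow, two_mul, pow_add, mul_assoc]
    have odd_term : cs.simple j * ((cs.simple i * cs.simple j) ^ n * p.1 *
        (cs.simple j * cs.simple i) ^ n) * cs.simple j = cs.simple i ↔
          p.1 = (cs.simple j * cs.simple i) ^ (2 * n + 1) * cs.simple j := by
      have hj := cs.inv_simple j
      rw [← eq_mul_inv_iff_mul_eq, ← eq_inv_mul_iff_mul_eq, hj, ← inv_pow_mul,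
        mul_inv_eq_iff_eq_mul, ← eq_inv_mul_iff_mul_eq, inv_pow_mul, ← mul_assoc (cs.simple j),
        mul_assoc _ (cs.simple j), ← conj_pow, two_mul, add_assoc, pow_add, add_comm n 1, pow_add,
        pow_one]
      simp only [mul_assoc]
    rw [pow_succ', functionEnd_mul_apply, ih, functionEnd_mul_apply]
    simp only [signedConj, even_term, odd_term, Nat.mul_succ, Finset.sum_range_succ, Prod.mk.injEq]
    refine ⟨?_, by ring⟩
    rw [pow_succ', pow_succ]
    simp only [mul_assoc]

theorem isLiftable_signedConj : M.IsLiftable cs.signedConj := by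
  classical
  intro i j
  funext p
  rw [signedConj_mul_pow_apply, two_mul, Finset.sum_range_add]
  simp [pow_add, CharTwo.add_self_eq_zero, Function.End.one_def]

open Classical in
theorem lift_signedConj_wordProd (ω : List B) (p : W × ZMod 2) :
    cs.lift ⟨cs.signedConj, cs.isLiftable_signedConj⟩ (cs.wordProd ω) p =
      (cs.wordProd ω * p.1 * (cs.wordProd ω)⁻¹, p.2 + (cs.rightInvSeq ω).count p.1) := by
  induction ω with
  | nil => simp [Function.End.one_def]
  | cons i ω ih =>
    have head_iff : cs.wordProd ω * p.1 * (cs.wordProd ω)⁻¹ = cs.simple i ↔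
        (cs.wordProd ω)⁻¹ * cs.simple i * cs.wordProd ω = p.1 := by
      rw [mul_inv_eq_iff_eq_mul, ← eq_inv_mul_iff_mul_eq, mul_assoc, eq_comm]
    rw [wordProd_cons, map_mul, functionEnd_mul_apply, ih, lift_apply_simple]
    simp only [signedConj, rightInvSeq, count_cons, beq_iff_eq, head_iff, mul_inv_rev, inv_simple,
      Nat.cast_add, Nat.cast_ite, Nat.cast_one, Nat.cast_zero, add_assoc]
    simp only [mul_assoc]

/-- The exchange property: a right descent of `w` occurs in the right inversion sequence of every
word for `w`. -/
theorem simple_mem_rightInvSeq {ω : List B} {i : B} (h : cs.IsRightDescent (cs.wordProd ω) i) :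
    cs.simple i ∈ cs.rightInvSeq ω := by
  classical
  obtain ⟨ω', hω', hprod⟩ := cs.exists_isReduced (cs.wordProd ω * cs.simple i)
  have hconcat : cs.wordProd (ω'.concat i) = cs.wordProd ω := by
    rw [wordProd_concat, ← hprod, simple_mul_simple_cancel_right]
  have hred : cs.IsReduced (ω'.concat i) := by
    have hlen := cs.isRightDescent_iff.mp h
    rw [hprod, hω'.eq] at hlen
    rw [IsReduced, hconcat, ← hlen, length_concat]
  have hmem : cs.simple i ∈ cs.rightInvSeq (ω'.concat i) := by
    rw [rightInvSeq_concat]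
    simp
  have hcount := count_eq_one_of_mem hred.nodup_rightInvSeq hmem
  have hparity := cs.lift_signedConj_wordProd ω (cs.simple i, 0)
  rw [← hconcat, lift_signedConj_wordProd, hcount] at hparity
  by_contra hnot
  simp [count_eq_zero_of_not_mem hnot] at hparity

theorem exists_lt_of_mem_rightInvSeq_alternatingWord (i j : B) (k : ℕ) {x : W}
    (hx : x ∈ cs.rightInvSeq (alternatingWord i j k)) :
    ∃ p < k, x = (cs.simple j * cs.simple i) ^ p * cs.simple j := by
  induction k generalizing i j x with
  | zero => simp [alternatingWord] at hx
  | succ k ih =>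
    rw [alternatingWord_succ, rightInvSeq_concat, concat_eq_append, mem_append, mem_map,
      mem_singleton] at hx
    rcases hx with ⟨y, hy, rfl⟩ | rfl
    · obtain ⟨p, hp, rfl⟩ := ih j i hy
      refine ⟨p + 1, by omega, ?_⟩
      simp only [MulAut.conj_apply, inv_simple, pow_succ]
      rw [← mul_assoc, ← mul_pow_mul]
      simp only [mul_assoc]
    · exact ⟨0, by omega, by simp⟩

theorem orderOf_simple_mul_simple_comm (i j : B) :
    orderOf (cs.simple i * cs.simple j) = orderOf (cs.simple j * cs.simple i) := by
  rw [← orderOf_inv, mul_inv_rev, inv_simple, inv_simple]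

/-- An element with right descents `i` and `j` has reduced expressions ending in each alternating
word in `i` and `j` of length at most the order of the product of the two reflections. -/
theorem exists_eq_mul_alternatingWord {w : W} {i j : B} (hi : cs.IsRightDescent w i)
    (hj : cs.IsRightDescent w j) (k : ℕ)
    (hk : orderOf (cs.simple i * cs.simple j) = 0 ∨ k ≤ orderOf (cs.simple i * cs.simple j)) :
    ∃ v, w = v * cs.wordProd (alternatingWord i j k) ∧ cs.length w = cs.length v + k := by
  induction k generalizing i j with
  | zero => exact ⟨w, by simp [alternatingWord], rfl⟩
  | succ k ih =>
    obtain ⟨v, hw, hlen⟩ := ih hj hi (by rw [orderOf_simple_mul_simple_comm]; omega)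
    obtain ⟨ω, hω, rfl⟩ := cs.exists_isReduced v
    have hword : w = cs.wordProd (ω ++ alternatingWord j i k) := by rw [hw, wordProd_append]
    have hmem := cs.simple_mem_rightInvSeq (hword ▸ hj)
    obtain ⟨n, hn, hget⟩ := mem_iff_getElem.mp hmem
    have herase := cs.wordProd_mul_getD_rightInvSeq (ω ++ alternatingWord j i k) n
    rw [getD_eq_getElem _ _ hn, hget, ← hword] at herase
    rcases lt_or_ge n ω.length with hlt | hge
    · rw [eraseIdx_append_of_lt_length hlt, wordProd_append] at herase
      have hprod : w = cs.wordProd (ω.eraseIdx n) * cs.wordProd (alternatingWord i j (k + 1)) := by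
        rw [alternatingWord_succ, wordProd_concat, ← mul_assoc, ← herase,
          simple_mul_simple_cancel_right]
      refine ⟨_, hprod, le_antisymm ?_ ?_⟩
      · have h₁ := cs.length_mul_le (cs.wordProd (ω.eraseIdx n))
          (cs.wordProd (alternatingWord i j (k + 1)))
        have h₂ := cs.length_wordProd_le (alternatingWord i j (k + 1))
        rw [← hprod] at h₁
        rw [length_alternatingWord] at h₂
        omega
      · have h₁ := cs.length_wordProd_le (ω.eraseIdx n)
        have h₂ := length_eraseIdx_add_one hlt
        rw [hω.eq] at hlen
        omega
    · exfalso
      rw [eraseIdx_append_of_length_le hge, wordProd_append, hw, mul_assoc, mul_left_cancel_iff,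
        ← wordProd_mul_getD_rightInvSeq, mul_left_cancel_iff] at herase
      have hbound : n - ω.length < (cs.rightInvSeq (alternatingWord j i k)).length := by
        simp only [length_rightInvSeq, length_append] at hn ⊢
        omega
      rw [getD_eq_getElem _ _ hbound] at herase
      obtain ⟨p, hp, hpow⟩ := cs.exists_lt_of_mem_rightInvSeq_alternatingWord j i k
        (herase ▸ getElem_mem hbound)
      have hone : (cs.simple i * cs.simple j) ^ (p + 1) = 1 := by
        have := congrArg (· * cs.simple i) hpow
        simp only [simple_mul_simple_cancel_right] at this
        rw [pow_succ, ← this, mul_assoc, simple_mul_simple_cancel_left, simple_mul_simple_self]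
      have hdvd := orderOf_dvd_of_pow_eq_one hone
      rcases hk with hk | hk
      · rw [hk, zero_dvd_iff] at hdvd
        omega
      · have := Nat.le_of_dvd p.succ_pos hdvd
        omega

/-- The hypotheses pass from `w` to an element that is shorter by five, whence the conclusion by
infinite descent. -/
theorem not_isRightDescent_of_eq_mul_srsr {r s t : B}
    (hrt : orderOf (cs.simple r * cs.simple t) = 2)
    (hst : orderOf (cs.simple s * cs.simple t) = 3)
    (hsr : orderOf (cs.simple s * cs.simple r) = 0 ∨ 6 ≤ orderOf (cs.simple s * cs.simple r))
    (w w₁ : W) (hw : w = w₁ * cs.simple s * cs.simple r * cs.simple s * cs.simple r)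
    (hlen : cs.length w = cs.length w₁ + 4) : ¬ cs.IsRightDescent w t := by
  induction hn : cs.length w using Nat.strong_induction_on generalizing w w₁ with
  | _ n ih =>
  intro ht
  have comm_rt : cs.simple t * cs.simple r = cs.simple r * cs.simple t := by
    have h := pow_orderOf_eq_one (cs.simple r * cs.simple t)
    rw [hrt, pow_two, mul_eq_one_iff_eq_inv, mul_inv_rev, inv_simple, inv_simple] at h
    exact h.symm
  have braid_st : cs.simple s * cs.simple t * cs.simple s =
      cs.simple t * cs.simple s * cs.simple t := by
    have h := pow_orderOf_eq_one (cs.simple s * cs.simple t)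
    rw [hst, pow_succ, pow_two, ← mul_assoc, ← mul_assoc, mul_assoc, mul_assoc,
      mul_eq_one_iff_eq_inv] at h
    simpa [mul_assoc] using h
  have rt_tail {x : W} (hr : cs.IsRightDescent x r) (ht : cs.IsRightDescent x t) :
      ∃ v, x = v * cs.simple t * cs.simple r ∧ cs.length x = cs.length v + 2 := by
    obtain ⟨v, hv, hl⟩ := cs.exists_eq_mul_alternatingWord ht hr 2
      (by rw [orderOf_simple_mul_simple_comm]; omega)
    exact ⟨v, by simpa [alternatingWord, wordProd, mul_assoc] using hv, hl⟩
  have st_tail {x : W} (hs : cs.IsRightDescent x s) (ht : cs.IsRightDescent x t) :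
      ∃ v, x = v * cs.simple s * cs.simple t * cs.simple s ∧ cs.length x = cs.length v + 3 := by
    obtain ⟨v, hv, hl⟩ := cs.exists_eq_mul_alternatingWord ht hs 3
      (by rw [orderOf_simple_mul_simple_comm]; omega)
    exact ⟨v, by simpa [alternatingWord, wordProd, mul_assoc] using hv, hl⟩
  have sr_tail {x : W} (hs : cs.IsRightDescent x s) (hr : cs.IsRightDescent x r) :
      ∃ v, x = v * cs.simple s * cs.simple r * cs.simple s * cs.simple r * cs.simple s *
        cs.simple r ∧ cs.length x = cs.length v + 6 := by
    obtain ⟨v, hv, hl⟩ := cs.exists_eq_mul_alternatingWord hs hr 6 hsr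
    exact ⟨v, by simpa [alternatingWord, wordProd, mul_assoc] using hv, hl⟩
  have len_s := cs.length_mul_simple w₁ s
  have len_sr := cs.length_mul_simple (w₁ * cs.simple s) r
  have len_srs := cs.length_mul_simple (w₁ * cs.simple s * cs.simple r) s
  have len_srsr := cs.length_mul_simple (w₁ * cs.simple s * cs.simple r * cs.simple s) r
  rw [← hw] at len_srsr
  have descent {x : W} {i : B} (y : W) (hx : x = y * cs.simple i)
      (hy : cs.length y < cs.length x) : cs.IsRightDescent x i := by
    rwa [IsRightDescent, hx, simple_mul_simple_cancel_right, ← hx]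
  obtain ⟨u, hu, hul⟩ := rt_tail (descent _ hw (by omega)) ht
  have hu' : w₁ * cs.simple s * cs.simple r * cs.simple s = u * cs.simple t :=
    mul_right_cancel (hw.symm.trans hu)
  obtain ⟨v, hv, hvl⟩ := st_tail (descent _ rfl (by omega)) (descent u hu' (by omega))
  have hv' := mul_right_cancel hv
  have len_vs := cs.length_mul_simple v s
  obtain ⟨y, hy, hyl⟩ := rt_tail (descent _ rfl (by omega)) (descent _ hv' (by omega))
  have hy' := mul_right_cancel hy
  have hvs : v * cs.simple s = y * cs.simple r := by
    rw [hy, mul_assoc, comm_rt, ← mul_assoc] at hv'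
    exact (mul_right_cancel hv').symm
  have len_yr := cs.length_mul_simple y r
  rw [← hvs] at len_yr
  have len_vst := cs.length_mul_simple (v * cs.simple s) t
  rw [← hv'] at len_vst
  obtain ⟨x, hx, hxl⟩ := st_tail (descent _ rfl (by omega)) (descent y hy' (by omega))
  have hyx : y = x * cs.simple t * cs.simple s := by
    refine mul_right_cancel (b := cs.simple t) ?_
    rw [← hy', hx]
    simpa only [mul_assoc] using congrArg (x * ·) braid_st
  obtain ⟨z, hz, hzl⟩ := sr_tail (descent v rfl (by omega)) (descent y hvs (by omega))
  rw [hvs, hyx] at hz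
  have hxt := mul_right_cancel (mul_right_cancel hz)
  have len_xt := cs.length_mul_simple x t
  have len_xts := cs.length_mul_simple (x * cs.simple t) s
  rw [← hyx] at len_xts
  exact ih (cs.length (x * cs.simple t)) (by omega) _ z hxt (by omega) rfl
    (descent x rfl (by omega))

end CoxeterSystem

/-- Corollary 3.3: there is no `w ∈ W` with `w = (w₁)(srsr) = (w₂)(t)`. -/
theorem no_element_srsr_and_t
{W : Type*} [Group W] {M : CoxeterMatrix (Fin 3)} (cs : CoxeterSystem M W)
    (r s t : W) (hr : r = cs.simple 0) (hs : s = cs.simple 1) (ht : t = cs.simple 2)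
    (hrt : orderOf (r * t) = 2)
    (hst : orderOf (s * t) = 3)
    (hsr : orderOf (s * r) = 0 ∨ 7 ≤ orderOf (s * r)) :
    ¬ ∃ w w1 w2 : W,
        w = w1 * s * r * s * r ∧ cs.length w = cs.length w1 + 4 ∧
        w = w2 * t ∧ cs.length w = cs.length w2 + 1 := by
  subst hr hs ht
  rintro ⟨w, w₁, w₂, hw, hlen, hw₂, hlen₂⟩
  refine cs.not_isRightDescent_of_eq_mul_srsr hrt hst (by omega) w w₁ hw hlen ?_
  rw [CoxeterSystem.IsRightDescent, hw₂, CoxeterSystem.simple_mul_simple_cancel_right, ← hw₂]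
  omega
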